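/- Let μ be a Borel measure on ℝ with μ({0}) = 0 and ∫_ℝ min(1,u²) μ(du) < ∞, satisfying μ((0,∞)) > 0 and ∫_{|u|≥1} e^{Cu} μ(du) < ∞ for every C ∈ ℝ. Assume conditions (T1) and (T2), the Kallenberg condition (N1): z² ∫_{(0,1/|z|)} u² μ(du)/ln|z| → +∞ as |z| → ∞, and Cramer's condition (C): for some ρ > 0 the restriction ϰ of μ to [ρ,∞) satisfies sup_{|z|≥ε} |∫ e^{iyz} ϰ(dy)| < ϰ(ℝ) for every ε > 0. Let ψ(z) = ∫_ℝ (e^{izu} − 1 − izu) μ(du), let ζ(y) for y ≥ 0 be the unique ζ ≥ 0 with M₁(ζ) = y, and set 𝒟_Z(y) = −y·ζ(y) + M₀(ζ(y)) and 𝒦_Z(y) = M₂(ζ(y)). Then for every t > 0 the function p_t(x) := (1/2π) ∫_ℝ e^{−izx + tψ(z)} dz is well defined, and for every t₀ > 0, p_t(x) · √(2π t 𝒦_Z(x/t)) · exp(−t·𝒟_Z(x/t)) → 1 as t + x → +∞ along (t,x) ∈ [t₀,∞) × [0,∞). -/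

import Mathlib

open MeasureTheory Filter Set

/-- The exponential moment functions `M_k` of a Lévy measure `μ`. -/
noncomputable def levyM (μ : Measure ℝ) : ℕ → ℝ → ℝ
  | 0, ξ => ∫ u, (Real.exp (ξ * u) - 1 - ξ * u) ∂μ
  | 1, ξ => ∫ u, u * (Real.exp (ξ * u) - 1) ∂μ
  | (n + 2), ξ => ∫ u, u ^ (n + 2) * Real.exp (ξ * u) ∂μ

/-- The characteristic exponent `ψ(z) = ∫ (e^{izu} − 1 − izu) μ(du)`. -/
noncomputable def levyPsi (μ : Measure ℝ) (z : ℝ) : ℂ :=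
  ∫ u, (Complex.exp (Complex.I * z * u) - 1 - Complex.I * z * u) ∂μ

section LevyAsymptotics

/-- Exponentially weighted second moments of `μ` are finite. -/
def ExpSqIntegrable (μ : Measure ℝ) : Prop :=
  ∀ r : ℝ, Integrable (fun u : ℝ => u ^ 2 * Real.exp (r * |u|)) μ

theorem expSqIntegrable_of_levy {μ : Measure ℝ}
    (hμint : Integrable (fun u : ℝ => min 1 (u ^ 2)) μ)
    (hμexp : ∀ C : ℝ, Integrable (fun u : ℝ => Real.exp (C * u))
      (μ.restrict {u : ℝ | 1 ≤ |u|})) : ExpSqIntegrable μ := by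
  intro r
  have hS : MeasurableSet {u : ℝ | 1 ≤ |u|} := measurableSet_le (by fun_prop) (by fun_prop)
  have hm : AEStronglyMeasurable (fun u : ℝ => u ^ 2 * Real.exp (r * |u|)) μ :=
    (by fun_prop : Continuous fun u : ℝ => u ^ 2 * Real.exp (r * |u|)).aestronglyMeasurable
  rw [← integrableOn_univ, ← union_compl_self {u : ℝ | 1 ≤ |u|}]
  refine IntegrableOn.union ?_ ?_
  · have h1 := ((hμexp (|r| + 1)).add (hμexp (-(|r| + 1)))).const_mul 2
    refine Integrable.mono' h1 hm.restrict ?_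
    filter_upwards with u
    simp only [Pi.add_apply]
    rw [Real.norm_of_nonneg (by positivity)]
    have h2 : u ^ 2 ≤ 2 * Real.exp |u| := by
      have := Real.quadratic_le_exp_of_nonneg (abs_nonneg u)
      nlinarith [sq_abs u, abs_nonneg u]
    have h3 : Real.exp (r * |u|) ≤ Real.exp (|r| * |u|) := by
      gcongr; exact le_abs_self r
    have h4 : Real.exp |u| * Real.exp (|r| * |u|) = Real.exp ((|r| + 1) * |u|) := by
      rw [← Real.exp_add]; ring_nf
    have h5 : Real.exp ((|r| + 1) * |u|)
        ≤ Real.exp ((|r| + 1) * u) + Real.exp (-(|r| + 1) * u) := by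
      rcases abs_cases u with h | h
      · rw [h.1]; linarith [Real.exp_pos (-(|r| + 1) * u)]
      · rw [h.1, show (|r| + 1) * -u = -(|r| + 1) * u by ring]
        linarith [Real.exp_pos ((|r| + 1) * u)]
    calc u ^ 2 * Real.exp (r * |u|) ≤ (2 * Real.exp |u|) * Real.exp (|r| * |u|) := by gcongr
      _ = 2 * Real.exp ((|r| + 1) * |u|) := by rw [mul_assoc, h4]
      _ ≤ _ := by linarith
  · refine Integrable.mono' (hμint.integrableOn.const_mul (Real.exp |r|)) hm.restrict ?_
    rw [ae_restrict_iff' hS.compl]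
    filter_upwards with u hu
    have hu' : |u| < 1 := by simpa using hu
    rw [Real.norm_of_nonneg (by positivity)]
    have h1 : u ^ 2 ≤ 1 := by nlinarith [sq_abs u, abs_nonneg u]
    rw [min_eq_right h1, mul_comm]
    gcongr
    calc r * |u| ≤ |r| * |u| := by gcongr; exact le_abs_self r
      _ ≤ |r| * 1 := by gcongr
      _ = |r| := mul_one _

theorem ExpSqIntegrable.integrable_of_le {μ : Measure ℝ} (h : ExpSqIntegrable μ)
    {E : Type*} [NormedAddCommGroup E] {f : ℝ → E} (hf : Continuous f) (C r : ℝ)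
    (hb : ∀ u, ‖f u‖ ≤ C * (u ^ 2 * Real.exp (r * |u|))) : Integrable f μ :=
  Integrable.mono' ((h r).const_mul C) hf.aestronglyMeasurable (Eventually.of_forall hb)

theorem exp_mul_le_exp_mul_abs {ξ r : ℝ} (hξ : |ξ| ≤ r) (u : ℝ) :
    Real.exp (ξ * u) ≤ Real.exp (r * |u|) := by
  refine Real.exp_le_exp.2 ?_
  calc ξ * u ≤ |ξ * u| := le_abs_self _
    _ = |ξ| * |u| := abs_mul _ _
    _ ≤ r * |u| := by gcongr

theorem ExpSqIntegrable.integrable_two {μ : Measure ℝ} (h : ExpSqIntegrable μ) (ξ : ℝ) :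
    Integrable (fun u : ℝ => u ^ 2 * Real.exp (ξ * u)) μ := by
  refine h.integrable_of_le (by fun_prop) 1 |ξ| fun u => ?_
  rw [Real.norm_of_nonneg (by positivity), one_mul]
  exact mul_le_mul_of_nonneg_left (exp_mul_le_exp_mul_abs le_rfl u) (sq_nonneg u)

theorem pow_four_mul_exp_le (ξ u : ℝ) :
    u ^ 4 * Real.exp (ξ * u) ≤ 2 * (u ^ 2 * Real.exp ((|ξ| + 1) * |u|)) := by
  have h2 : u ^ 2 ≤ 2 * Real.exp |u| := by
    have := Real.quadratic_le_exp_of_nonneg (abs_nonneg u)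
    nlinarith [sq_abs u, abs_nonneg u]
  calc u ^ 4 * Real.exp (ξ * u) = u ^ 2 * (u ^ 2 * Real.exp (ξ * u)) := by ring
    _ ≤ u ^ 2 * ((2 * Real.exp |u|) * Real.exp (|ξ| * |u|)) := by
        refine mul_le_mul_of_nonneg_left ?_ (sq_nonneg u)
        exact mul_le_mul h2 (exp_mul_le_exp_mul_abs le_rfl u) (by positivity) (by positivity)
    _ = 2 * (u ^ 2 * Real.exp ((|ξ| + 1) * |u|)) := by
        rw [mul_assoc 2, ← Real.exp_add, show |u| + |ξ| * |u| = (|ξ| + 1) * |u| by ring]; ring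

theorem ExpSqIntegrable.integrable_four {μ : Measure ℝ} (h : ExpSqIntegrable μ) (ξ : ℝ) :
    Integrable (fun u : ℝ => u ^ 4 * Real.exp (ξ * u)) μ := by
  refine h.integrable_of_le (by fun_prop) 2 (|ξ| + 1) fun u => ?_
  rw [Real.norm_of_nonneg (by positivity)]
  exact pow_four_mul_exp_le ξ u

theorem norm_cexp_sub_one_sub_le (w : ℂ) {r : ℝ} (hw : ‖w‖ ≤ r) (u : ℝ) :
    ‖Complex.exp (w * u) - 1 - w * u‖ ≤ r ^ 2 * (u ^ 2 * Real.exp (r * |u|)) := by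
  have h := Complex.norm_exp_sub_sum_le_norm_mul_exp (w * u) 2
  simp only [Finset.sum_range_succ, Finset.sum_range_zero, pow_zero, Nat.factorial_zero,
    Nat.cast_one, div_one, zero_add, pow_one, Nat.factorial_one, norm_mul, Complex.norm_real,
    Real.norm_eq_abs] at h
  rw [sub_sub]
  refine h.trans ?_
  rw [mul_pow, sq_abs, mul_assoc]
  gcongr

theorem norm_cexp_sub_one_le (w : ℂ) {r : ℝ} (hw : ‖w‖ ≤ r) (u : ℝ) :
    ‖(u : ℂ) * (Complex.exp (w * u) - 1)‖ ≤ r * (u ^ 2 * Real.exp (r * |u|)) := by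
  have h := Complex.norm_exp_sub_sum_le_norm_mul_exp (w * u) 1
  simp only [Finset.sum_range_succ, Finset.sum_range_zero, pow_zero, Nat.factorial_zero,
    Nat.cast_one, div_one, zero_add, pow_one, norm_mul, Complex.norm_real,
    Real.norm_eq_abs] at h
  rw [norm_mul, Complex.norm_real, Real.norm_eq_abs]
  calc |u| * ‖Complex.exp (w * u) - 1‖ ≤ |u| * (‖w‖ * |u| * Real.exp (‖w‖ * |u|)) := by gcongr
    _ ≤ |u| * (r * |u| * Real.exp (r * |u|)) := by
        have := (norm_nonneg w).trans hw
        gcongr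
    _ = r * (|u| ^ 2 * Real.exp (r * |u|)) := by ring
    _ = _ := by rw [sq_abs]

/-- The Laplace exponent `φ(w) = ∫ (e^{wu} − 1 − wu) μ(du)`, for complex `w`. -/
noncomputable def levyPhi (μ : Measure ℝ) (w : ℂ) : ℂ :=
  ∫ u : ℝ, (Complex.exp (w * u) - 1 - w * u) ∂μ

/-- The compensated exponent of the Lévy measure `e^{ξu} μ(du)`. -/
noncomputable def tiltedPsi (μ : Measure ℝ) (ξ z : ℝ) : ℂ :=
  ∫ u : ℝ, (Real.exp (ξ * u) : ℂ) *
    (Complex.exp (Complex.I * z * u) - 1 - Complex.I * z * u) ∂μ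

/-- The decay exponent `∫ e^{ξu} (1 − cos(zu)) μ(du)`. -/
noncomputable def tiltedDecay (μ : Measure ℝ) (ξ z : ℝ) : ℝ :=
  ∫ u : ℝ, Real.exp (ξ * u) * (1 - Real.cos (z * u)) ∂μ

theorem ExpSqIntegrable.integrable_phi {μ : Measure ℝ} (h : ExpSqIntegrable μ) (w : ℂ) :
    Integrable (fun u : ℝ => Complex.exp (w * u) - 1 - w * u) μ :=
  h.integrable_of_le (by fun_prop) _ _ fun u => norm_cexp_sub_one_sub_le w le_rfl u

theorem ExpSqIntegrable.integrable_one {μ : Measure ℝ} (h : ExpSqIntegrable μ) (w : ℂ) :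
    Integrable (fun u : ℝ => (u : ℂ) * (Complex.exp (w * u) - 1)) μ :=
  h.integrable_of_le (by fun_prop) _ _ fun u => norm_cexp_sub_one_le w le_rfl u

theorem ExpSqIntegrable.integrable_real_one {μ : Measure ℝ} (h : ExpSqIntegrable μ) (ξ : ℝ) :
    Integrable (fun u : ℝ => u * (Real.exp (ξ * u) - 1)) μ := by
  simpa [← Complex.ofReal_mul, ← Complex.ofReal_exp] using (h.integrable_one ξ).re

theorem ExpSqIntegrable.integrable_tiltedPsi {μ : Measure ℝ} (h : ExpSqIntegrable μ) (ξ z : ℝ) :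
    Integrable (fun u : ℝ => (Real.exp (ξ * u) : ℂ) *
      (Complex.exp (Complex.I * z * u) - 1 - Complex.I * z * u)) μ := by
  have h1 := (h.integrable_phi (ξ + Complex.I * z)).sub (h.integrable_phi ξ)
  have h2 := h1.sub ((h.integrable_one ξ).const_mul (Complex.I * z))
  refine h2.congr (Eventually.of_forall fun u => ?_)
  simp only [Pi.sub_apply, add_mul, Complex.exp_add, Complex.ofReal_exp, Complex.ofReal_mul]
  ring

theorem ExpSqIntegrable.levyPhi_shift {μ : Measure ℝ} (h : ExpSqIntegrable μ) (ξ z : ℝ) :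
    levyPhi μ (ξ + Complex.I * z) =
      levyM μ 0 ξ + Complex.I * z * levyM μ 1 ξ + tiltedPsi μ ξ z := by
  have e0 : (levyM μ 0 ξ : ℂ) = ∫ u : ℝ, (Complex.exp (ξ * u) - 1 - ξ * u) ∂μ := by
    rw [levyM, ← integral_complex_ofReal]; simp
  have e1 : (levyM μ 1 ξ : ℂ) = ∫ u : ℝ, (u : ℂ) * (Complex.exp (ξ * u) - 1) ∂μ := by
    rw [levyM, ← integral_complex_ofReal]; simp
  have i1 := (h.integrable_one ξ).const_mul (Complex.I * z)
  rw [e0, e1, ← integral_const_mul, ← integral_add (h.integrable_phi ξ) i1, tiltedPsi]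
  refine Eq.trans ?_ (integral_add ((h.integrable_phi ξ).add i1) (h.integrable_tiltedPsi ξ z))
  refine integral_congr_ae (Eventually.of_forall fun u => ?_)
  simp only [add_mul, Complex.exp_add, Complex.ofReal_exp, Complex.ofReal_mul]
  ring

theorem re_tiltedPsi_integrand (a z u : ℝ) :
    ((Real.exp a : ℂ) * (Complex.exp (Complex.I * z * u) - 1 - Complex.I * z * u)).re =
      -(Real.exp a * (1 - Real.cos (z * u))) := by
  have h1 : Complex.I * z * u = ((z * u : ℝ) : ℂ) * Complex.I := by push_cast; ring
  rw [Complex.re_ofReal_mul, h1, Complex.sub_re, Complex.sub_re, Complex.exp_ofReal_mul_I_re,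
    Complex.one_re, Complex.re_ofReal_mul, Complex.I_re]
  ring

theorem ExpSqIntegrable.integrable_tiltedDecay {μ : Measure ℝ} (h : ExpSqIntegrable μ)
    (ξ z : ℝ) : Integrable (fun u : ℝ => Real.exp (ξ * u) * (1 - Real.cos (z * u))) μ := by
  refine (h.integrable_tiltedPsi ξ z).re.neg.congr (Eventually.of_forall fun u => ?_)
  simp only [Pi.neg_apply, RCLike.re_eq_complex_re, re_tiltedPsi_integrand, neg_neg]

theorem ExpSqIntegrable.re_tiltedPsi {μ : Measure ℝ} (h : ExpSqIntegrable μ)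
    (ξ z : ℝ) : (tiltedPsi μ ξ z).re = -tiltedDecay μ ξ z := by
  have h1 : (tiltedPsi μ ξ z).re = _ := (integral_re (h.integrable_tiltedPsi ξ z)).symm
  rw [h1, tiltedDecay, ← integral_neg]
  exact integral_congr_ae (Eventually.of_forall fun u => re_tiltedPsi_integrand _ z u)

theorem ExpSqIntegrable.differentiable_levyPhi {μ : Measure ℝ} (h : ExpSqIntegrable μ) :
    Differentiable ℂ (levyPhi μ) := by
  intro w
  have := hasDerivAt_integral_of_dominated_loc_of_deriv_le (μ := μ) (𝕜 := ℂ)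
    (F := fun w u => Complex.exp (w * (u : ℝ)) - 1 - w * u)
    (F' := fun w u => (u : ℂ) * (Complex.exp (w * u) - 1)) (x₀ := w) (s := Metric.ball w 1)
    (bound := fun u => (‖w‖ + 1) * (u ^ 2 * Real.exp ((‖w‖ + 1) * |u|)))
    (Metric.ball_mem_nhds w one_pos)
    (Eventually.of_forall fun w => (h.integrable_phi w).aestronglyMeasurable)
    (h.integrable_phi w) (h.integrable_one w).aestronglyMeasurable
    (Eventually.of_forall fun u v hv => ?_) ((h _).const_mul _)
    (Eventually.of_forall fun u v hv => ?_)
  · exact this.2.differentiableAt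
  · refine norm_cexp_sub_one_le v ?_ u
    have h1 : ‖v - w‖ < 1 := by simpa [dist_eq_norm] using hv
    linarith [norm_sub_norm_le v w]
  · have h1 : HasDerivAt (fun v : ℂ => v * (u : ℂ)) (u : ℂ) v := by
      simpa using (hasDerivAt_id v).mul_const (u : ℂ)
    exact ((h1.cexp.sub_const 1).sub h1).congr_deriv (by ring)

theorem sq_div_two_sub_le_one_sub_cos (x : ℝ) :
    x ^ 2 / 2 - x ^ 4 / 2 ≤ 1 - Real.cos x := by
  rcases le_total |x| 1 with h | h
  · have := (abs_le.1 (Real.cos_bound h)).2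
    rw [show |x| ^ 4 = x ^ 4 by rw [← abs_pow, abs_of_nonneg (by positivity)]] at this
    nlinarith [show 0 ≤ x ^ 4 by positivity]
  · have h1 : 1 ≤ x ^ 2 := by rw [← sq_abs]; nlinarith
    nlinarith [Real.cos_le_one x]

theorem sq_div_four_le_one_sub_cos {x : ℝ} (h : |x| ≤ 1) : x ^ 2 / 4 ≤ 1 - Real.cos x := by
  have := (abs_le.1 (Real.cos_bound h)).2
  rw [show |x| ^ 4 = x ^ 4 by rw [← abs_pow, abs_of_nonneg (by positivity)]] at this
  have h1 : x ^ 2 ≤ 1 := by rw [← sq_abs]; nlinarith [abs_nonneg x]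
  nlinarith [sq_nonneg x]

theorem levyM_two (μ : Measure ℝ) (ξ : ℝ) :
    levyM μ 2 ξ = ∫ u, u ^ 2 * Real.exp (ξ * u) ∂μ := rfl

theorem levyM_four (μ : Measure ℝ) (ξ : ℝ) :
    levyM μ 4 ξ = ∫ u, u ^ 4 * Real.exp (ξ * u) ∂μ := rfl

theorem levyM_four_nonneg (μ : Measure ℝ) (ξ : ℝ) : 0 ≤ levyM μ 4 ξ := by
  rw [levyM_four]
  exact integral_nonneg fun u => by positivity

theorem ExpSqIntegrable.restrict {μ : Measure ℝ} (h : ExpSqIntegrable μ) (s : Set ℝ) :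
    ExpSqIntegrable (μ.restrict s) := fun r => (h r).integrableOn

theorem ExpSqIntegrable.le_tiltedDecay {μ : Measure ℝ} (h : ExpSqIntegrable μ) {ξ z : ℝ}
    (hz : z ^ 2 * levyM μ 4 ξ ≤ levyM μ 2 ξ / 2) :
    z ^ 2 * levyM μ 2 ξ / 4 ≤ tiltedDecay μ ξ z := by
  have h1 : z ^ 2 / 2 * levyM μ 2 ξ - z ^ 4 / 2 * levyM μ 4 ξ ≤ tiltedDecay μ ξ z := by
    rw [levyM_two, levyM_four, ← integral_const_mul, ← integral_const_mul, ← integral_sub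
      ((h.integrable_two ξ).const_mul _) ((h.integrable_four ξ).const_mul _)]
    refine integral_mono (((h.integrable_two ξ).const_mul _).sub
      ((h.integrable_four ξ).const_mul _)) (h.integrable_tiltedDecay ξ z) fun u => ?_
    have := mul_le_mul_of_nonneg_left (sq_div_two_sub_le_one_sub_cos (z * u))
      (Real.exp_pos (ξ * u)).le
    dsimp only
    calc _ = Real.exp (ξ * u) * ((z * u) ^ 2 / 2 - (z * u) ^ 4 / 2) := by ring
      _ ≤ _ := this
  nlinarith [mul_le_mul_of_nonneg_left hz (sq_nonneg z)]

/-- Restricting the Lévy measure to a set decreases the decay exponent. -/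
theorem ExpSqIntegrable.tiltedDecay_restrict_le {μ : Measure ℝ} (h : ExpSqIntegrable μ)
    (s : Set ℝ) (ξ z : ℝ) : tiltedDecay (μ.restrict s) ξ z ≤ tiltedDecay μ ξ z :=
  integral_mono_measure Measure.restrict_le_self
    (Eventually.of_forall fun _ => mul_nonneg (Real.exp_pos _).le
      (sub_nonneg.2 (Real.cos_le_one _))) (h.integrable_tiltedDecay ξ z)

theorem levyTail_lt_top {μ : Measure ℝ}
    (hμint : Integrable (fun u : ℝ => min 1 (u ^ 2)) μ) {ρ : ℝ} (hρ : 0 < ρ) :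
    μ (Set.Ici ρ) < ⊤ := by
  have h0 : 0 < min 1 (ρ ^ 2) := by positivity
  refine (measure_mono ?_).trans_lt (hμint.measure_norm_ge_lt_top h0)
  intro u hu
  have hu : ρ ≤ u := hu
  have : ρ ^ 2 ≤ u ^ 2 := by gcongr
  simp only [mem_ofPred_eq]
  rw [Real.norm_of_nonneg (by positivity)]
  exact min_le_min_left 1 this

theorem ExpSqIntegrable.le_levyM_two {μ : Measure ℝ} (h : ExpSqIntegrable μ)
    (hμint : Integrable (fun u : ℝ => min 1 (u ^ 2)) μ) {ρ ξ : ℝ} (hρ : 0 < ρ) (hξ : 0 ≤ ξ) :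
    ρ ^ 2 * (μ (Set.Ici ρ)).toReal * Real.exp (ξ * ρ) ≤ levyM μ 2 ξ := by
  have hfin := levyTail_lt_top hμint hρ
  have h1 : ∫ u in Set.Ici ρ, u ^ 2 * Real.exp (ξ * u) ∂μ ≤ levyM μ 2 ξ :=
    setIntegral_le_integral (h.integrable_two ξ) (Eventually.of_forall fun u => by positivity)
  refine le_trans ?_ h1
  have h2 : ∫ u in Set.Ici ρ, ρ ^ 2 * Real.exp (ξ * ρ) ∂μ
      = ρ ^ 2 * (μ (Set.Ici ρ)).toReal * Real.exp (ξ * ρ) := by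
    rw [setIntegral_const, smul_eq_mul, measureReal_def]; ring
  rw [← h2]
  refine setIntegral_mono_on ?_ (h.integrable_two ξ).integrableOn measurableSet_Ici ?_
  · exact integrableOn_const hfin.ne
  · intro u hu
    have hu : ρ ≤ u := hu
    gcongr

theorem exists_cramer_le_tiltedDecay {μ : Measure ℝ} (h : ExpSqIntegrable μ)
    (hμint : Integrable (fun u : ℝ => min 1 (u ^ 2)) μ) {ρ : ℝ} (hρ : 0 < ρ)
    (hC : ∀ ε > (0 : ℝ), ∃ c : ℝ, c < (μ (Set.Ici ρ)).toReal ∧ ∀ z : ℝ, ε ≤ |z| →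
        ‖∫ y in Set.Ici ρ, Complex.exp (Complex.I * y * z) ∂μ‖ ≤ c) :
    ∃ c > 0, ∀ ξ ≥ 0, ∀ z : ℝ,
      c * min 1 (z ^ 2) * Real.exp (ξ * ρ) ≤ tiltedDecay μ ξ z := by
  have hfin := levyTail_lt_top hμint hρ
  have : IsFiniteMeasure (μ.restrict (Set.Ici ρ)) := ⟨by simpa using hfin⟩
  set ν := μ.restrict (Set.Ici ρ) with hν
  set κ := (μ (Set.Ici ρ)).toReal with hκ
  have hνs := h.restrict (Set.Ici ρ)
  have hκ0 : 0 < κ := by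
    obtain ⟨c, hc, hc'⟩ := hC 1 one_pos
    exact ((norm_nonneg _).trans (hc' 1 (by simp))).trans_lt hc
  have hA : 0 < levyM ν 2 0 := by
    have h2 : levyM ν 2 0 = ∫ u in Set.Ici ρ, u ^ 2 ∂μ := by
      rw [levyM_two]; simp [hν]
    have h3 : ∫ u in Set.Ici ρ, ρ ^ 2 ∂μ ≤ ∫ u in Set.Ici ρ, u ^ 2 ∂μ := by
      refine setIntegral_mono_on (integrableOn_const hfin.ne)
        (by simpa using (h.integrable_two 0).integrableOn) measurableSet_Ici fun u hu => ?_
      have hu : ρ ≤ u := hu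
      gcongr
    rw [setIntegral_const, smul_eq_mul, measureReal_def] at h3
    rw [h2]
    exact lt_of_lt_of_le (by positivity) h3
  set A := levyM ν 2 0
  set B := levyM ν 4 0
  have hB : 0 ≤ B := levyM_four_nonneg ν 0
  set ε := Real.sqrt (A / (2 * (B + 1))) with hε
  have hε2 : ε ^ 2 = A / (2 * (B + 1)) := Real.sq_sqrt (by positivity)
  have hε0 : 0 < ε := Real.sqrt_pos.2 (by positivity)
  obtain ⟨c, hc, hc'⟩ := hC ε hε0
  have key : ∀ z : ℝ, min (A / 4) (κ - c) * min 1 (z ^ 2) ≤ tiltedDecay ν 0 z := by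
    intro z
    rcases le_total ε |z| with hz | hz
    · have h1 : κ - c ≤ tiltedDecay ν 0 z := by
        have hi : Integrable (fun y : ℝ => Complex.exp (Complex.I * y * z)) ν := by
          refine Integrable.of_bound (C := 1) (by fun_prop) (Eventually.of_forall fun y => ?_)
          rw [show Complex.I * y * z = ((y * z : ℝ) : ℂ) * Complex.I by push_cast; ring,
            Complex.norm_exp_ofReal_mul_I]
        have hr : (∫ y, Complex.exp (Complex.I * y * z) ∂ν).re = _ := (integral_re hi).symm
        have h4 : tiltedDecay ν 0 z = κ - (∫ y, Complex.exp (Complex.I * y * z) ∂ν).re := by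
          have h5 : κ = ∫ y, (1 : ℝ) ∂ν := by simp [hν, hκ, measureReal_def]
          rw [hr, h5, ← integral_sub (integrable_const _) hi.re, tiltedDecay]
          refine integral_congr_ae (Eventually.of_forall fun u => ?_)
          dsimp only
          rw [show Complex.I * u * z = ((z * u : ℝ) : ℂ) * Complex.I by push_cast; ring,
            RCLike.re_eq_complex_re, Complex.exp_ofReal_mul_I_re]
          simp
        rw [h4]
        linarith [(Complex.re_le_norm _).trans (hc' z hz)]
      refine le_trans ?_ h1
      calc min (A / 4) (κ - c) * min 1 (z ^ 2) ≤ (κ - c) * 1 := by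
            refine mul_le_mul (min_le_right _ _) (min_le_left _ _) (by positivity) ?_
            linarith
        _ = κ - c := mul_one _
    · have h1 : z ^ 2 ≤ A / (2 * (B + 1)) := by rw [← hε2, ← sq_abs z]; gcongr
      have h2 : z ^ 2 * B ≤ A / 2 := by
        rw [le_div_iff₀ (by positivity)] at h1
        nlinarith [sq_nonneg z]
      refine le_trans ?_ (hνs.le_tiltedDecay h2)
      calc min (A / 4) (κ - c) * min 1 (z ^ 2) ≤ (A / 4) * z ^ 2 :=
            mul_le_mul (min_le_left _ _) (min_le_right _ _) (by positivity) (by positivity)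
        _ = z ^ 2 * A / 4 := by ring
  refine ⟨min (A / 4) (κ - c), lt_min (by positivity) (by linarith), fun ξ hξ z => ?_⟩
  refine le_trans ?_ (h.tiltedDecay_restrict_le (Set.Ici ρ) ξ z)
  refine (mul_le_mul_of_nonneg_right (key z) (Real.exp_pos _).le).trans ?_
  rw [tiltedDecay, ← integral_mul_const]
  refine setIntegral_mono_on ((hνs.integrable_tiltedDecay 0 z).mul_const _)
    (hνs.integrable_tiltedDecay ξ z) measurableSet_Ici fun u hu => ?_
  have hu : ρ ≤ u := hu
  have h6 : Real.exp (ξ * ρ) ≤ Real.exp (ξ * u) := by gcongr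
  rw [zero_mul, Real.exp_zero, one_mul, mul_comm]
  exact mul_le_mul_of_nonneg_right h6 (sub_nonneg.2 (Real.cos_le_one _))

theorem exists_log_le_tiltedDecay {μ : Measure ℝ} (h : ExpSqIntegrable μ)
    (hN1 : Tendsto (fun z : ℝ => z ^ 2 * (∫ u in Set.Ioo 0 |z|⁻¹, u ^ 2 ∂μ) / Real.log |z|)
      (comap (fun z : ℝ => |z|) atTop) atTop) (K : ℝ) :
    ∃ Z ≥ (1 : ℝ), ∀ ξ ≥ 0, ∀ z : ℝ, Z ≤ |z| → K * Real.log |z| ≤ tiltedDecay μ ξ z := by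
  have h1 := hN1.eventually_ge_atTop (4 * K)
  rw [eventually_comap] at h1
  obtain ⟨Z, hZ⟩ := eventually_atTop.1 h1
  refine ⟨max Z 2, le_max_of_le_right one_le_two, fun ξ hξ z hz => ?_⟩
  have hz2 : 2 ≤ |z| := (le_max_right _ _).trans hz
  have h2 := hZ |z| ((le_max_left _ _).trans hz) z rfl
  have hlog : 0 < Real.log |z| := Real.log_pos (by linarith)
  rw [le_div_iff₀ hlog] at h2
  refine le_trans ?_ (h.tiltedDecay_restrict_le (Set.Ioo 0 |z|⁻¹) ξ z)
  have h3 : K * Real.log |z| ≤ z ^ 2 / 4 * ∫ u in Set.Ioo 0 |z|⁻¹, u ^ 2 ∂μ := by linarith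
  refine h3.trans ?_
  rw [← integral_const_mul, tiltedDecay]
  have hi : Integrable (fun u : ℝ => u ^ 2) μ := by simpa using h.integrable_two 0
  refine setIntegral_mono_on (hi.integrableOn.const_mul _)
    ((h.restrict _).integrable_tiltedDecay ξ z) measurableSet_Ioo fun u hu => ?_
  have h4 : |z * u| ≤ 1 := by
    rw [abs_mul, abs_of_pos hu.1]
    calc |z| * u ≤ |z| * |z|⁻¹ := by gcongr; exact hu.2.le
      _ = 1 := mul_inv_cancel₀ (by linarith)
  have h5 := sq_div_four_le_one_sub_cos h4
  have h6 : 1 ≤ Real.exp (ξ * u) := Real.one_le_exp (mul_nonneg hξ hu.1.le)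
  calc z ^ 2 / 4 * u ^ 2 = 1 * ((z * u) ^ 2 / 4) := by ring
    _ ≤ _ := mul_le_mul h6 h5 (by positivity) (by positivity)

theorem tiltedDecay_nonneg (μ : Measure ℝ) (ξ z : ℝ) : 0 ≤ tiltedDecay μ ξ z :=
  integral_nonneg fun _ => mul_nonneg (Real.exp_pos _).le (sub_nonneg.2 (Real.cos_le_one _))

theorem exists_exp_neg_tiltedDecay_le {μ : Measure ℝ} (h : ExpSqIntegrable μ)
    (hN1 : Tendsto (fun z : ℝ => z ^ 2 * (∫ u in Set.Ioo 0 |z|⁻¹, u ^ 2 ∂μ) / Real.log |z|)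
      (comap (fun z : ℝ => |z|) atTop) atTop) {t₀ : ℝ} (ht₀ : 0 < t₀) :
    ∃ C > 0, ∀ t ≥ t₀, ∀ ξ ≥ 0, ∀ z : ℝ,
      Real.exp (-(t * tiltedDecay μ ξ z)) ≤ C * (1 + z ^ 2)⁻¹ := by
  obtain ⟨Z, hZ1, hZ⟩ := exists_log_le_tiltedDecay h hN1 (2 / t₀)
  refine ⟨2 + Z ^ 2, by positivity, fun t ht ξ hξ z => ?_⟩
  rw [← div_eq_mul_inv, le_div_iff₀ (by positivity)]
  rcases le_total Z |z| with hz | hz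
  · have hz0 : 0 < |z| := by linarith
    have hz1 : 1 ≤ z ^ 2 := by rw [← sq_abs]; nlinarith
    have h1 := hZ ξ hξ z hz
    have h2 : 2 * Real.log |z| ≤ t * tiltedDecay μ ξ z := by
      calc 2 * Real.log |z| = t₀ * (2 / t₀ * Real.log |z|) := by field_simp
        _ ≤ t₀ * tiltedDecay μ ξ z := by gcongr
        _ ≤ _ := by gcongr; exact tiltedDecay_nonneg μ ξ z
    have h3 : Real.exp (-(t * tiltedDecay μ ξ z)) ≤ (z ^ 2)⁻¹ := by
      rw [Real.exp_neg]
      gcongr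
      calc z ^ 2 = |z| ^ 2 := (sq_abs z).symm
        _ = Real.exp (2 * Real.log |z|) := by
          rw [two_mul, Real.exp_add, Real.exp_log hz0, sq]
        _ ≤ _ := Real.exp_le_exp.2 h2
    calc _ ≤ (z ^ 2)⁻¹ * (1 + z ^ 2) := by gcongr
      _ = (z ^ 2)⁻¹ + 1 := by rw [mul_add, mul_one, inv_mul_cancel₀ (by linarith)]
      _ ≤ 1 + 1 := by gcongr; exact inv_le_one_of_one_le₀ hz1
      _ ≤ 2 + Z ^ 2 := by nlinarith
  · have h1 : Real.exp (-(t * tiltedDecay μ ξ z)) ≤ 1 := by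
      rw [Real.exp_le_one_iff]
      have := mul_nonneg (ht₀.le.trans ht) (tiltedDecay_nonneg μ ξ z)
      linarith
    have h2 : z ^ 2 ≤ Z ^ 2 := by rw [← sq_abs]; gcongr
    calc _ ≤ 1 * (1 + z ^ 2) := by gcongr
      _ ≤ 2 + Z ^ 2 := by linarith

/-- Shifting the contour of integration of an entire function with quadratic decay in a
horizontal strip. -/
theorem integral_eq_integral_sub_I_mul {F : ℂ → ℂ} (hF : Differentiable ℂ F) {ξ C : ℝ}
    (hξ : 0 ≤ ξ) (hb : ∀ s ∈ Set.Icc 0 ξ, ∀ z : ℝ,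
      ‖F (z - Complex.I * s)‖ ≤ C * (1 + z ^ 2)⁻¹) :
    ∫ z : ℝ, F z = ∫ z : ℝ, F (z - Complex.I * ξ) := by
  have hFint : ∀ s ∈ Set.Icc 0 ξ, Integrable fun z : ℝ => F (z - Complex.I * s) := fun s hs =>
    (integrable_inv_one_add_sq.const_mul C).mono'
      (hF.continuous.comp (by fun_prop)).aestronglyMeasurable
      (Eventually.of_forall (hb s hs))
  have i0 : Integrable fun z : ℝ => F z := by simpa using hFint 0 ⟨le_rfl, hξ⟩
  have i1 := hFint ξ ⟨hξ, le_rfl⟩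
  have l0 := intervalIntegral_tendsto_integral i0 tendsto_neg_atTop_atBot tendsto_id
  have l1 := intervalIntegral_tendsto_integral i1 tendsto_neg_atTop_atBot tendsto_id
  have hv : ∀ A : ℝ, ‖∫ y : ℝ in -ξ..0, F (A + y * Complex.I)‖ ≤ C * (1 + A ^ 2)⁻¹ * ξ := by
    intro A
    have := intervalIntegral.norm_integral_le_of_norm_le_const
      (f := fun y : ℝ => F (A + y * Complex.I)) (a := -ξ) (b := 0) (C := C * (1 + A ^ 2)⁻¹) ?_
    · simpa [abs_of_nonneg hξ] using this
    · intro y hy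
      rw [uIoc_of_le (by linarith)] at hy
      have e : (A : ℂ) + y * Complex.I = A - Complex.I * ((-y : ℝ) : ℂ) := by push_cast; ring
      rw [e]
      exact hb (-y) ⟨by linarith [hy.2], by linarith [hy.1]⟩ A
  have hd : Tendsto (fun A : ℝ => (∫ x in -A..id A, F (x - Complex.I * ξ)) -
      ∫ x in -A..id A, F x) atTop (nhds 0) := by
    have hz : Tendsto (fun A : ℝ => 2 * (C * (1 + A ^ 2)⁻¹ * ξ)) atTop (nhds 0) := by
      have h1 : Tendsto (fun A : ℝ => (1 + A ^ 2)⁻¹) atTop (nhds 0) :=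
        (tendsto_atTop_add_const_left _ _ (tendsto_pow_atTop two_ne_zero)).inv_tendsto_atTop
      simpa using ((h1.const_mul C).mul_const ξ).const_mul 2
    refine squeeze_zero_norm (fun A => ?_) hz
    have hr := Complex.integral_boundary_rect_eq_zero_of_differentiableOn F ⟨-A, -ξ⟩ ⟨A, 0⟩
      hF.differentiableOn
    have e1 : ∀ x : ℝ, (x : ℂ) + ((-ξ : ℝ) : ℂ) * Complex.I = x - Complex.I * ξ := by
      intro x; push_cast; ring
    simp only [e1, Complex.ofReal_zero, zero_mul, add_zero, smul_eq_mul] at hr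
    have h2 : (∫ x in -A..A, F (x - Complex.I * ξ)) - ∫ x in -A..A, F x =
        Complex.I * (∫ y : ℝ in -ξ..0, F ((-A : ℝ) + y * Complex.I)) -
          Complex.I * ∫ y : ℝ in -ξ..0, F (A + y * Complex.I) := by
      linear_combination hr
    simp only [id]
    rw [h2]
    refine (norm_sub_le _ _).trans ?_
    rw [norm_mul, norm_mul, Complex.norm_I, one_mul, one_mul]
    have h3 := hv A
    have h4 := hv (-A)
    rw [neg_sq] at h4
    linarith
  have := tendsto_nhds_unique hd (l1.sub l0)
  exact (sub_eq_zero.1 this.symm).symm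

theorem ExpSqIntegrable.norm_levyM_zero_le {μ : Measure ℝ} (h : ExpSqIntegrable μ) {s ξ : ℝ}
    (hs : s ∈ Set.Icc 0 ξ) :
    levyM μ 0 s ≤ ξ ^ 2 * ∫ u, u ^ 2 * Real.exp (ξ * |u|) ∂μ := by
  have hi : Integrable (fun u : ℝ => Real.exp (s * u) - 1 - s * u) μ := by
    simpa [← Complex.ofReal_mul, ← Complex.ofReal_exp] using (h.integrable_phi s).re
  rw [← integral_const_mul]
  refine integral_mono hi ((h ξ).const_mul _) fun u => ?_
  have hn : ‖(s : ℂ)‖ ≤ ξ := by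
    rw [Complex.norm_real, Real.norm_of_nonneg hs.1]; exact hs.2
  have := norm_cexp_sub_one_sub_le (s : ℂ) hn u
  have e : Complex.exp (s * u) - 1 - s * u =
      ((Real.exp (s * u) - 1 - s * u : ℝ) : ℂ) := by push_cast; rfl
  rw [e] at this
  exact (le_abs_self _).trans ((Complex.norm_real _).symm.le.trans this)

theorem ExpSqIntegrable.norm_cexp_tiltedPsi {μ : Measure ℝ} (h : ExpSqIntegrable μ)
    (t ξ z : ℝ) : ‖Complex.exp (t * tiltedPsi μ ξ z)‖ =
      Real.exp (-(t * tiltedDecay μ ξ z)) := by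
  rw [Complex.norm_exp, Complex.re_ofReal_mul, h.re_tiltedPsi, mul_neg]

theorem ExpSqIntegrable.continuous_tiltedPsi {μ : Measure ℝ} (h : ExpSqIntegrable μ) (ξ : ℝ) :
    Continuous (tiltedPsi μ ξ) := by
  have h1 : tiltedPsi μ ξ = fun z : ℝ => levyPhi μ (ξ + Complex.I * z) -
      (levyM μ 0 ξ + Complex.I * z * levyM μ 1 ξ) := by
    funext z; rw [h.levyPhi_shift]; ring
  rw [h1]
  exact (h.differentiable_levyPhi.continuous.comp (by fun_prop)).sub (by fun_prop)

theorem levyM_one_zero (μ : Measure ℝ) : levyM μ 1 0 = 0 := by simp [levyM]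

theorem tiltedPsi_zero (μ : Measure ℝ) (z : ℝ) : tiltedPsi μ 0 z = levyPsi μ z := by
  simp [tiltedPsi, levyPsi]

theorem ExpSqIntegrable.integrable_cexp_tiltedPsi {μ : Measure ℝ} (h : ExpSqIntegrable μ)
    {t ξ C : ℝ} (hb : ∀ z : ℝ, Real.exp (-(t * tiltedDecay μ ξ z)) ≤ C * (1 + z ^ 2)⁻¹) :
    Integrable fun z : ℝ => Complex.exp (t * tiltedPsi μ ξ z) := by
  have := h.continuous_tiltedPsi ξ
  refine (integrable_inv_one_add_sq.const_mul C).mono' (by fun_prop)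
    (Eventually.of_forall fun z => ?_)
  rw [h.norm_cexp_tiltedPsi]
  exact hb z

/-- Fourier inversion along the shifted (saddle point) contour. -/
theorem ExpSqIntegrable.integral_cexp_levyPsi {μ : Measure ℝ} (h : ExpSqIntegrable μ)
    {t x ξ C : ℝ} (ht : 0 < t) (hx : 0 ≤ x) (hξ : 0 ≤ ξ) (hxi : x = t * levyM μ 1 ξ)
    (hb : ∀ s ≥ 0, ∀ z : ℝ, Real.exp (-(t * tiltedDecay μ s z)) ≤ C * (1 + z ^ 2)⁻¹) :
    ∫ z : ℝ, Complex.exp (-(Complex.I * z * x) + t * levyPsi μ z) =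
      (Real.exp (t * levyM μ 0 ξ - x * ξ) : ℂ) *
        ∫ z : ℝ, Complex.exp (t * tiltedPsi μ ξ z) := by
  set F : ℂ → ℂ := fun w => Complex.exp (-(Complex.I * w * x) + t * levyPhi μ (Complex.I * w))
    with hFdef
  have hF : Differentiable ℂ F := by
    have h1 : Differentiable ℂ fun w => levyPhi μ (Complex.I * w) :=
      h.differentiable_levyPhi.comp (by fun_prop)
    fun_prop
  have hFs : ∀ s z : ℝ, F (z - Complex.I * s) =
      Complex.exp ((t * levyM μ 0 s - x * s : ℝ) + ((t * levyM μ 1 s - x) * z : ℝ) * Complex.I) *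
        Complex.exp (t * tiltedPsi μ s z) := by
    intro s z
    have h2 : Complex.I * (z - Complex.I * s) = s + Complex.I * z := by
      linear_combination -(s : ℂ) * Complex.I_sq
    rw [hFdef, ← Complex.exp_add]
    dsimp only
    rw [h2, h.levyPhi_shift]
    congr 1
    push_cast
    ring
  set B : ℝ := ξ ^ 2 * ∫ u, u ^ 2 * Real.exp (ξ * |u|) ∂μ with hB
  have hbound : ∀ s ∈ Set.Icc 0 ξ, ∀ z : ℝ,
      ‖F (z - Complex.I * s)‖ ≤ Real.exp (t * B) * C * (1 + z ^ 2)⁻¹ := by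
    intro s hs z
    rw [hFs, norm_mul, h.norm_cexp_tiltedPsi, mul_assoc]
    refine mul_le_mul ?_ (hb s hs.1 z) (Real.exp_pos _).le (Real.exp_pos _).le
    rw [Complex.norm_exp, Complex.add_re, Complex.ofReal_re, Complex.re_ofReal_mul,
      Complex.I_re, mul_zero, add_zero]
    refine Real.exp_le_exp.2 ?_
    have h3 := h.norm_levyM_zero_le hs
    have h4 : t * levyM μ 0 s ≤ t * B := by gcongr
    linarith [mul_nonneg hx hs.1]
  have := integral_eq_integral_sub_I_mul hF hξ hbound
  refine this.trans ?_
  rw [← integral_const_mul]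
  refine integral_congr_ae (Eventually.of_forall fun z => ?_)
  dsimp only
  rw [hFs, ← hxi]
  simp

theorem norm_cexp_I_remainder_le (a : ℝ) :
    ‖Complex.exp (Complex.I * a) - 1 - Complex.I * a + a ^ 2 / 2‖ ≤ 5 * |a| ^ 3 := by
  have hn : ‖Complex.I * (a : ℂ)‖ = |a| := by simp
  rcases le_total |a| 1 with ha | ha
  · have h := Complex.norm_exp_sub_sum_le_norm_mul_exp (Complex.I * a) 3
    rw [hn] at h
    have e : Complex.exp (Complex.I * a) - ∑ m ∈ Finset.range 3,
        (Complex.I * a) ^ m / (m.factorial : ℂ) =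
        Complex.exp (Complex.I * a) - 1 - Complex.I * a + a ^ 2 / 2 := by
      simp [Finset.sum_range_succ, Nat.factorial, mul_pow]
      ring
    rw [e] at h
    have h1 : Real.exp |a| ≤ 5 := by
      have h2 : Real.exp |a| ≤ Real.exp 1 := Real.exp_le_exp.2 ha
      linarith [Real.exp_one_lt_d9]
    refine h.trans ?_
    rw [mul_comm]
    gcongr
  · have h1 : ‖Complex.exp (Complex.I * a)‖ = 1 := by
      rw [mul_comm, Complex.norm_exp_ofReal_mul_I]
    have h2 : ‖(a : ℂ) ^ 2 / 2‖ = |a| ^ 2 / 2 := by simp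
    calc _ ≤ ‖Complex.exp (Complex.I * a)‖ + ‖(1 : ℂ)‖ + ‖Complex.I * (a : ℂ)‖
          + ‖(a : ℂ) ^ 2 / 2‖ :=
          (norm_add_le _ _).trans (add_le_add_left ((norm_sub_le _ _).trans
            (add_le_add_left (norm_sub_le _ _) _)) _)
      _ = 2 + |a| + |a| ^ 2 / 2 := by rw [h1, h2, hn, norm_one]; ring
      _ ≤ 5 * |a| ^ 3 := by
        have h3 : 1 ≤ |a| ^ 2 := one_le_pow₀ ha
        have h4 : |a| ^ 2 ≤ |a| ^ 3 := pow_le_pow_right₀ ha (by norm_num)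
        have h5 : |a| ≤ |a| ^ 3 := le_self_pow₀ ha (by norm_num)
        linarith

theorem abs_pow_three_le (a : ℝ) {l : ℝ} (hl : 0 < l) :
    |a| ^ 3 ≤ (l * a ^ 2 + a ^ 4 / l) / 2 := by
  have h1 : a ^ 2 = |a| ^ 2 := (sq_abs a).symm
  have h2 : a ^ 4 = |a| ^ 4 := by rw [← abs_pow, abs_of_nonneg (by positivity)]
  rw [h1, h2, le_div_iff₀ two_pos, ← sub_nonneg,
    show l * |a| ^ 2 + |a| ^ 4 / l - |a| ^ 3 * 2 = |a| ^ 2 / l * (l - |a|) ^ 2 by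
      field_simp; ring]
  positivity

theorem ExpSqIntegrable.norm_tiltedPsi_add_le {μ : Measure ℝ} (h : ExpSqIntegrable μ)
    (ξ z : ℝ) {l : ℝ} (hl : 0 < l) :
    ‖tiltedPsi μ ξ z + (z ^ 2 * levyM μ 2 ξ / 2 : ℝ)‖ ≤
      5 / 2 * (l * (z ^ 2 * levyM μ 2 ξ) + z ^ 4 * levyM μ 4 ξ / l) := by
  have i2 := h.integrable_two ξ
  have i4 := h.integrable_four ξ
  have e : ((z ^ 2 * levyM μ 2 ξ / 2 : ℝ) : ℂ) =
      ∫ u : ℝ, ((z ^ 2 / 2 * (u ^ 2 * Real.exp (ξ * u)) : ℝ) : ℂ) ∂μ := by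
    rw [integral_complex_ofReal, integral_const_mul, levyM_two]
    congr 1; ring
  have i2c : Integrable (fun u : ℝ => ((z ^ 2 / 2 * (u ^ 2 * Real.exp (ξ * u)) : ℝ) : ℂ)) μ :=
    (i2.const_mul _).ofReal
  rw [e, tiltedPsi, ← integral_add (h.integrable_tiltedPsi ξ z) i2c]
  have e2 : 5 / 2 * (l * (z ^ 2 * levyM μ 2 ξ) + z ^ 4 * levyM μ 4 ξ / l) =
      ∫ u : ℝ, (5 / 2 * l * z ^ 2 * (u ^ 2 * Real.exp (ξ * u)) +
        5 / 2 * z ^ 4 / l * (u ^ 4 * Real.exp (ξ * u))) ∂μ := by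
    rw [integral_add (i2.const_mul _) (i4.const_mul _), integral_const_mul, integral_const_mul,
      levyM_two, levyM_four]
    ring
  rw [e2]
  refine norm_integral_le_of_norm_le ((i2.const_mul _).add (i4.const_mul _))
    (Eventually.of_forall fun u => ?_)
  have e3 : (Real.exp (ξ * u) : ℂ) * (Complex.exp (Complex.I * z * u) - 1 - Complex.I * z * u) +
      ((z ^ 2 / 2 * (u ^ 2 * Real.exp (ξ * u)) : ℝ) : ℂ) = (Real.exp (ξ * u) : ℂ) *
      (Complex.exp (Complex.I * (z * u : ℝ)) - 1 - Complex.I * (z * u : ℝ)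
        + ((z * u : ℝ) : ℂ) ^ 2 / 2) := by
    push_cast
    rw [mul_assoc Complex.I]
    ring
  rw [e3, norm_mul, Complex.norm_real, Real.norm_of_nonneg (Real.exp_pos _).le]
  calc _ ≤ Real.exp (ξ * u) * (5 * ((l * (z * u) ^ 2 + (z * u) ^ 4 / l) / 2)) := by
        gcongr
        exact (norm_cexp_I_remainder_le _).trans
          (mul_le_mul_of_nonneg_left (abs_pow_three_le _ hl) (by norm_num))
    _ = _ := by ring

/-- The saddle point integral is asymptotically Gaussian as soon as the Lyapunov ratio and
the contribution of large frequencies vanish. -/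
theorem ExpSqIntegrable.tendsto_saddle_integral {μ : Measure ℝ} (h : ExpSqIntegrable μ)
    {ι : Type*} {L : Filter ι} [L.IsCountablyGenerated] {τ ξ : ι → ℝ} {ρ c C : ℝ}
    (hτ : ∀ᶠ i in L, 0 < τ i) (hξ : ∀ᶠ i in L, 0 ≤ ξ i)
    (hM : ∀ x ≥ 0, 0 < levyM μ 2 x) (hC0 : 0 < C) (hc0 : 0 < c)
    (hc : ∀ x ≥ 0, ∀ z : ℝ, c * min 1 (z ^ 2) * Real.exp (x * ρ) ≤ tiltedDecay μ x z)
    (hC : ∀ᶠ i in L, ∀ z : ℝ,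
      Real.exp (-(τ i / 2 * tiltedDecay μ (ξ i) z)) ≤ C * (1 + z ^ 2)⁻¹)
    (hs : Tendsto (fun i => (levyM μ 4 (ξ i) + levyM μ 2 (ξ i)) /
      (τ i * levyM μ 2 (ξ i) ^ 2)) L (nhds 0))
    (hT : Tendsto (fun i => Real.sqrt (τ i * levyM μ 2 (ξ i)) *
      Real.exp (-(c / 4 * (τ i * (levyM μ 2 (ξ i) / (levyM μ 4 (ξ i) + levyM μ 2 (ξ i)) *
        Real.exp (ξ i * ρ)))))) L (nhds 0)) :
    Tendsto (fun i => (Real.sqrt (τ i * levyM μ 2 (ξ i)) : ℂ) *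
      ∫ z : ℝ, Complex.exp (τ i * tiltedPsi μ (ξ i) z)) L
      (nhds (Real.sqrt (2 * Real.pi) : ℂ)) := by
  set b : ι → ℝ := fun i => Real.sqrt (τ i * levyM μ 2 (ξ i)) with hb
  set s : ι → ℝ := fun i => (levyM μ 4 (ξ i) + levyM μ 2 (ξ i)) /
      (τ i * levyM μ 2 (ξ i) ^ 2) with hsdef
  set T : ι → ℝ := fun i => Real.sqrt (τ i * levyM μ 2 (ξ i)) *
      Real.exp (-(c / 4 * (τ i * (levyM μ 2 (ξ i) / (levyM μ 4 (ξ i) + levyM μ 2 (ξ i)) *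
        Real.exp (ξ i * ρ))))) with hTdef
  set S : ι → Set ℝ := fun i => {z : ℝ | z ^ 2 *
    (2 * (levyM μ 4 (ξ i) + levyM μ 2 (ξ i))) ≤ levyM μ 2 (ξ i)} with hSdef
  have hSm : ∀ i, MeasurableSet (S i) := fun i => measurableSet_le (by fun_prop) (by fun_prop)
  set f : ι → ℝ → ℂ := fun i z => Complex.exp (τ i * tiltedPsi μ (ξ i) z) with hf
  have hfm : ∀ i, Continuous (f i) := fun i => by
    have := h.continuous_tiltedPsi (ξ i)
    fun_prop
  have hfn : ∀ i z, ‖f i z‖ = Real.exp (-(τ i * tiltedDecay μ (ξ i) z)) := fun i z =>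
    h.norm_cexp_tiltedPsi _ _ _
  have hfi : ∀ᶠ i in L, Integrable (f i) := by
    filter_upwards [hτ, hC] with i h1 h2
    refine h.integrable_cexp_tiltedPsi (C := C) fun z => (Real.exp_le_exp.2 ?_).trans (h2 z)
    have := mul_nonneg h1.le (tiltedDecay_nonneg μ (ξ i) z)
    linarith
  -- facts about the scale
  have hbpos : ∀ᶠ i in L, 0 < b i := by
    filter_upwards [hτ, hξ] with i h1 h2
    exact Real.sqrt_pos.2 (mul_pos h1 (hM _ h2))
  have hbsq : ∀ᶠ i in L, b i ^ 2 = τ i * levyM μ 2 (ξ i) := by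
    filter_upwards [hτ, hξ] with i h1 h2
    exact Real.sq_sqrt (mul_pos h1 (hM _ h2)).le
  -- central part
  have hcentral : Tendsto (fun i => ∫ w : ℝ, (S i).indicator (f i) (w / b i)) L
      (nhds (∫ w : ℝ, ((Real.exp (-(1 / 2) * w ^ 2) : ℝ) : ℂ))) := by
    refine tendsto_integral_filter_of_dominated_convergence
      (fun w => Real.exp (-(1 / 4) * w ^ 2)) (Eventually.of_forall fun i => ?_) ?_
      (integrable_exp_neg_mul_sq (by norm_num)) (Eventually.of_forall fun w => ?_)
    · exact (((hfm i).measurable.indicator (hSm i)).comp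
        (measurable_id.div_const _)).aestronglyMeasurable
    · filter_upwards [hτ, hξ, hbpos, hbsq] with i h1 h2 h3 h4
      refine Eventually.of_forall fun w => ?_
      by_cases hw : w / b i ∈ S i
      · rw [indicator_of_mem hw, hfn]
        refine Real.exp_le_exp.2 ?_
        have h5 : (w / b i) ^ 2 * levyM μ 4 (ξ i) ≤ levyM μ 2 (ξ i) / 2 := by
          have h6 : (w / b i) ^ 2 *
            (2 * (levyM μ 4 (ξ i) + levyM μ 2 (ξ i))) ≤ levyM μ 2 (ξ i) := hw
          nlinarith [mul_nonneg (sq_nonneg (w / b i)) (hM _ h2).le]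
        have h7 := mul_le_mul_of_nonneg_left (h.le_tiltedDecay h5) h1.le
        have h8 : τ i * ((w / b i) ^ 2 * levyM μ 2 (ξ i) / 4) = 1 / 4 * w ^ 2 := by
          have h9 := hM _ h2
          rw [div_pow, h4]
          field_simp
        linarith
      · rw [indicator_of_notMem hw, norm_zero]
        exact (Real.exp_pos _).le
    · have hmem : ∀ᶠ i in L, w / b i ∈ S i := by
        have h1 : Tendsto (fun i => 2 * w ^ 2 * s i) L (nhds 0) := by
          simpa using hs.const_mul (2 * w ^ 2)
        filter_upwards [hτ, hξ, hbsq, h1.eventually_lt_const one_pos] with i h2 h3 h4 h5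
        have h6 := hM _ h3
        change (w / b i) ^ 2 * (2 * (levyM μ 4 (ξ i) + levyM μ 2 (ξ i))) ≤ levyM μ 2 (ξ i)
        have h7 : (w / b i) ^ 2 * (2 * (levyM μ 4 (ξ i) + levyM μ 2 (ξ i))) =
            (2 * w ^ 2 * s i) * levyM μ 2 (ξ i) := by
          rw [div_pow, h4, hsdef]
          field_simp
        rw [h7]
        nlinarith
      have hlim : Tendsto (fun i => (τ i : ℂ) * tiltedPsi μ (ξ i) (w / b i)) L
          (nhds ((-(1 / 2) * w ^ 2 : ℝ) : ℂ)) := by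
        rw [tendsto_iff_norm_sub_tendsto_zero]
        have h1 : Tendsto (fun i => 5 / 2 * Real.sqrt (s i) * (w ^ 2 + w ^ 4)) L (nhds 0) := by
          have := (Real.continuous_sqrt.tendsto 0).comp hs
          rw [Real.sqrt_zero] at this
          simpa using (this.const_mul (5 / 2)).mul_const (w ^ 2 + w ^ 4)
        refine squeeze_zero' (Eventually.of_forall fun i => norm_nonneg _) ?_ h1
        filter_upwards [hτ, hξ, hbsq, hbpos] with i h2 h3 h4 h5
        have h6 := hM _ h3
        have h7 := levyM_four_nonneg μ (ξ i)
        have hs0 : 0 < s i := by rw [hsdef]; positivity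
        have hl := Real.sqrt_pos.2 hs0
        have h8 := h.norm_tiltedPsi_add_le (ξ i) (w / b i) hl
        have h9 : (w / b i) ^ 2 * levyM μ 2 (ξ i) = w ^ 2 / τ i := by
          rw [div_pow, h4]; field_simp
        rw [h9] at h8
        have e1 : (τ i : ℂ) * tiltedPsi μ (ξ i) (w / b i) - ((-(1 / 2) * w ^ 2 : ℝ) : ℂ) =
            (τ i : ℂ) * (tiltedPsi μ (ξ i) (w / b i) + (w ^ 2 / τ i / 2 : ℝ)) := by
          have : (τ i : ℂ) ≠ 0 := by exact_mod_cast h2.ne'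
          push_cast
          field_simp
          ring
        rw [e1, norm_mul, Complex.norm_real, Real.norm_of_nonneg h2.le]
        have h10 : τ i * ((w / b i) ^ 4 * levyM μ 4 (ξ i)) ≤ w ^ 4 * s i := by
          have : (w / b i) ^ 4 = w ^ 4 / (τ i * levyM μ 2 (ξ i)) ^ 2 := by
            rw [← h4, div_pow]; ring
          have hsi : s i = (levyM μ 4 (ξ i) + levyM μ 2 (ξ i)) /
            (τ i * levyM μ 2 (ξ i) ^ 2) := rfl
          rw [this, hsi]
          have : τ i * (w ^ 4 / (τ i * levyM μ 2 (ξ i)) ^ 2 * levyM μ 4 (ξ i)) =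
            w ^ 4 * (levyM μ 4 (ξ i) / (τ i * levyM μ 2 (ξ i) ^ 2)) := by field_simp
          rw [this]
          gcongr
          linarith
        have h11 : s i / Real.sqrt (s i) = Real.sqrt (s i) := Real.div_sqrt
        calc _ ≤ τ i * (5 / 2 * (Real.sqrt (s i) * (w ^ 2 / τ i) +
                (w / b i) ^ 4 * levyM μ 4 (ξ i) / Real.sqrt (s i))) := by gcongr
          _ = 5 / 2 * (Real.sqrt (s i) * w ^ 2 +
                τ i * ((w / b i) ^ 4 * levyM μ 4 (ξ i)) / Real.sqrt (s i)) := by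
              field_simp
          _ ≤ 5 / 2 * (Real.sqrt (s i) * w ^ 2 + w ^ 4 * s i / Real.sqrt (s i)) := by gcongr
          _ = _ := by rw [mul_div_assoc, h11]; ring
      rw [Complex.ofReal_exp]
      refine ((Complex.continuous_exp.tendsto _).comp hlim).congr' ?_
      filter_upwards [hmem] with i hi
      rw [indicator_of_mem hi]
      simp [hf]
  have hgauss : ∫ w : ℝ, ((Real.exp (-(1 / 2) * w ^ 2) : ℝ) : ℂ) =
      (Real.sqrt (2 * Real.pi) : ℂ) := by
    rw [integral_complex_ofReal, integral_gaussian]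
    congr 2; ring
  rw [hgauss] at hcentral
  -- tail part
  have htail : Tendsto (fun i => (b i : ℂ) * ∫ z : ℝ, (S i)ᶜ.indicator (f i) z) L (nhds 0) := by
    have h0 : Tendsto (fun i => T i * (C * ∫ z : ℝ, (1 + z ^ 2)⁻¹)) L (nhds 0) := by
      have := hT.mul_const (C * ∫ z : ℝ, (1 + z ^ 2)⁻¹)
      rwa [zero_mul] at this
    refine squeeze_zero_norm' ?_ h0
    filter_upwards [hτ, hξ, hC] with i h1 h2 h3
    have h6 := hM _ h2
    have h7 := levyM_four_nonneg μ (ξ i)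
    rw [norm_mul, Complex.norm_real, Real.norm_of_nonneg (Real.sqrt_nonneg _), hTdef]
    dsimp only
    rw [mul_assoc]
    refine mul_le_mul_of_nonneg_left ?_ (Real.sqrt_nonneg _)
    rw [← integral_const_mul, ← integral_const_mul]
    refine norm_integral_le_of_norm_le ((integrable_inv_one_add_sq.const_mul _).const_mul _)
      (Eventually.of_forall fun z => ?_)
    by_cases hz : z ∈ S i
    · rw [indicator_of_notMem (by simpa using hz), norm_zero]
      positivity
    · rw [indicator_of_mem (by simpa using hz), hfn]
      have e : -(τ i * tiltedDecay μ (ξ i) z) = -(τ i / 2 * tiltedDecay μ (ξ i) z) +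
        -(τ i / 2 * tiltedDecay μ (ξ i) z) := by ring
      rw [e, Real.exp_add]
      refine mul_le_mul (Real.exp_le_exp.2 ?_) (h3 z) (Real.exp_pos _).le (Real.exp_pos _).le
      have h8 : levyM μ 2 (ξ i) < z ^ 2 * (2 * (levyM μ 4 (ξ i) + levyM μ 2 (ξ i))) := by
        simpa [hSdef] using hz
      set q := levyM μ 2 (ξ i) / (levyM μ 4 (ξ i) + levyM μ 2 (ξ i)) with hq
      have h9 : q / 2 ≤ min 1 (z ^ 2) := by
        refine le_min ?_ ?_
        · have : q ≤ 1 := by rw [hq, div_le_one (by positivity)]; linarith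
          linarith
        · rw [hq, div_div, div_le_iff₀ (by positivity)]
          linarith
      have h10 := hc _ h2 z
      have h11 : c * (q / 2) * Real.exp (ξ i * ρ) ≤ tiltedDecay μ (ξ i) z :=
        le_trans (by gcongr) h10
      have h12 : τ i / 2 * (c * (q / 2) * Real.exp (ξ i * ρ)) ≤
        τ i / 2 * tiltedDecay μ (ξ i) z := by gcongr
      linarith
  have hsum := hcentral.add htail
  rw [add_zero] at hsum
  refine hsum.congr' ?_
  filter_upwards [hfi, hbpos] with i h1 h2
  rw [Measure.integral_comp_div (g := (S i).indicator (f i)), abs_of_pos h2,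
    Complex.real_smul, ← mul_add, ← integral_add (h1.indicator (hSm i))
      (h1.indicator (hSm i).compl)]
  congr 1
  refine integral_congr_ae (Eventually.of_forall fun z => ?_)
  exact congrFun (indicator_self_add_compl (S i) (f i)) z

theorem ExpSqIntegrable.levyM_one_mono {μ : Measure ℝ} (h : ExpSqIntegrable μ) {ξ R : ℝ}
    (hR : ξ ≤ R) : levyM μ 1 ξ ≤ levyM μ 1 R := by
  refine integral_mono (h.integrable_real_one ξ) (h.integrable_real_one R) fun u => ?_
  dsimp only
  rcases le_total 0 u with hu | hu
  · gcongr
  · refine mul_le_mul_of_nonpos_left (sub_le_sub_right (Real.exp_le_exp.2 ?_) 1) hu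
    exact mul_le_mul_of_nonpos_right hR hu

theorem exp_mul_le_one_add_exp_mul {ξ R : ℝ} (hξ : 0 ≤ ξ) (hR : ξ ≤ R) (u : ℝ) :
    Real.exp (ξ * u) ≤ 1 + Real.exp (R * u) := by
  rcases le_total 0 u with hu | hu
  · have : Real.exp (ξ * u) ≤ Real.exp (R * u) := by gcongr
    linarith
  · have : Real.exp (ξ * u) ≤ 1 := Real.exp_le_one_iff.2 (mul_nonpos_of_nonneg_of_nonpos hξ hu)
    linarith [Real.exp_pos (R * u)]

theorem ExpSqIntegrable.levyM_two_le {μ : Measure ℝ} (h : ExpSqIntegrable μ) {ξ R : ℝ}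
    (hξ : 0 ≤ ξ) (hR : ξ ≤ R) : levyM μ 2 ξ ≤ levyM μ 2 0 + levyM μ 2 R := by
  rw [levyM_two, levyM_two, levyM_two,
    ← integral_add (h.integrable_two 0) (h.integrable_two R)]
  refine integral_mono (h.integrable_two ξ) ((h.integrable_two 0).add (h.integrable_two R))
    fun u => ?_
  have := mul_le_mul_of_nonneg_left (exp_mul_le_one_add_exp_mul hξ hR u) (sq_nonneg u)
  simp only [zero_mul, Real.exp_zero]
  linarith

theorem ExpSqIntegrable.levyM_four_le {μ : Measure ℝ} (h : ExpSqIntegrable μ) {ξ R : ℝ}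
    (hξ : 0 ≤ ξ) (hR : ξ ≤ R) : levyM μ 4 ξ ≤ levyM μ 4 0 + levyM μ 4 R := by
  rw [levyM_four, levyM_four, levyM_four,
    ← integral_add (h.integrable_four 0) (h.integrable_four R)]
  refine integral_mono (h.integrable_four ξ) ((h.integrable_four 0).add (h.integrable_four R))
    fun u => ?_
  have := mul_le_mul_of_nonneg_left (exp_mul_le_one_add_exp_mul hξ hR u)
    (show 0 ≤ u ^ 4 by positivity)
  simp only [zero_mul, Real.exp_zero]
  linarith

/-- The space-time filter: `t + x → ∞` along `[t₀, ∞) × [0, ∞)`. -/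
def spaceTimeFilter (t₀ : ℝ) : Filter (ℝ × ℝ) :=
  comap (fun q : ℝ × ℝ => q.1 + q.2) atTop ⊓ 𝓟 {q | t₀ ≤ q.1 ∧ 0 ≤ q.2}

instance (t₀ : ℝ) : (spaceTimeFilter t₀).IsCountablyGenerated := by
  unfold spaceTimeFilter; infer_instance

theorem eventually_spaceTimeFilter {t₀ : ℝ} {P : ℝ × ℝ → Prop} :
    (∀ᶠ q in spaceTimeFilter t₀, P q) ↔
      ∃ N : ℝ, ∀ t x : ℝ, t₀ ≤ t → 0 ≤ x → N ≤ t + x → P (t, x) := by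
  rw [spaceTimeFilter, eventually_inf_principal, eventually_comap, eventually_atTop]
  constructor
  · rintro ⟨N, hN⟩
    exact ⟨N, fun t x h1 h2 h3 => hN (t + x) h3 (t, x) rfl ⟨h1, h2⟩⟩
  · rintro ⟨N, hN⟩
    exact ⟨N, fun b hb q hq hq' => hN q.1 q.2 hq'.1 hq'.2 (by rw [hq]; exact hb)⟩

/-- Convergence along the space-time filter follows from convergence for large saddle points
and, for bounded saddle points, for large times. -/
theorem ExpSqIntegrable.tendsto_spaceTimeFilter {μ : Measure ℝ} (h : ExpSqIntegrable μ)
    {t₀ : ℝ} (ht₀ : 0 < t₀) {ζ : ℝ → ℝ} (hζ : ∀ y : ℝ, 0 ≤ y → 0 ≤ ζ y ∧ levyM μ 1 (ζ y) = y)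
    {g : ℝ → ℝ → ℝ} (hg : ∀ t ξ, 0 ≤ t → 0 ≤ ξ → 0 ≤ g t ξ)
    {g₁ : ℝ → ℝ} (hg₁ : Tendsto g₁ atTop (nhds 0))
    (hg₁' : ∀ᶠ ξ in atTop, ∀ t ≥ t₀, g t ξ ≤ g₁ ξ)
    (hg₂ : ∀ R ≥ 0, ∃ g₂ : ℝ → ℝ, Tendsto g₂ atTop (nhds 0) ∧
      ∀ᶠ t in atTop, ∀ ξ ∈ Set.Icc 0 R, g t ξ ≤ g₂ t) :
    Tendsto (fun q : ℝ × ℝ => g q.1 (ζ (q.2 / q.1))) (spaceTimeFilter t₀) (nhds 0) := by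
  rw [tendsto_order]
  refine ⟨fun a ha => ?_, fun a ha => ?_⟩ <;> rw [eventually_spaceTimeFilter]
  · refine ⟨0, fun t x ht hx _ => ha.trans_le (hg t _ (ht₀.le.trans ht) (hζ _ ?_).1)⟩
    exact div_nonneg hx (ht₀.le.trans ht)
  · obtain ⟨R, hR⟩ := eventually_atTop.1
      ((hg₁.eventually_lt_const ha).and (hg₁'.and (eventually_ge_atTop 0)))
    have hR0 := (hR R le_rfl).2.2
    obtain ⟨g₂, hg₂, hg₂'⟩ := hg₂ R hR0
    obtain ⟨T, hT⟩ := eventually_atTop.1 ((hg₂.eventually_lt_const ha).and hg₂')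
    have hM := h.levyM_one_mono hR0
    rw [levyM_one_zero] at hM
    refine ⟨T * (1 + levyM μ 1 R), fun t x ht hx hN => ?_⟩
    have ht' : 0 < t := ht₀.trans_le ht
    obtain ⟨h1, h2⟩ := hζ (x / t) (div_nonneg hx ht'.le)
    set ξ := ζ (x / t)
    rcases le_total R ξ with hξ | hξ
    · exact ((hR ξ hξ).2.1 t ht).trans_lt (hR ξ hξ).1
    · have h3 : x ≤ t * levyM μ 1 R := by
        rw [mul_comm, ← div_le_iff₀ ht', ← h2]
        exact h.levyM_one_mono hξ
      have h4 : T ≤ t := by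
        have h5 : T * (1 + levyM μ 1 R) ≤ t * (1 + levyM μ 1 R) := by linarith
        exact le_of_mul_le_mul_right h5 (by linarith)
      exact ((hT t h4).2 ξ ⟨h1, hξ⟩).trans_lt (hT t h4).1

theorem sqrt_mul_exp_neg_le {k t : ℝ} (hk : 0 < k) (ht : 0 < t) :
    Real.sqrt t * Real.exp (-(k * t)) ≤ 1 / k * (Real.sqrt t)⁻¹ := by
  have h1 : Real.exp (-(k * t)) ≤ (k * t)⁻¹ := by
    rw [Real.exp_neg]
    have := Real.add_one_le_exp (k * t)
    exact inv_anti₀ (by positivity) (by linarith)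
  have h2 := Real.sqrt_pos.2 ht
  calc _ ≤ Real.sqrt t * (k * t)⁻¹ := by gcongr
    _ = Real.sqrt t * (k * (Real.sqrt t * Real.sqrt t))⁻¹ := by rw [Real.mul_self_sqrt ht.le]
    _ = _ := by field_simp

theorem tendsto_levyM_two {μ : Measure ℝ} {m ρ : ℝ} (hm : 0 < m) (hρ : 0 < ρ)
    (hM : ∀ ξ ≥ 0, m * Real.exp (ξ * ρ) ≤ levyM μ 2 ξ) :
    Tendsto (levyM μ 2) atTop atTop := by
  have h1 : Tendsto (fun ξ : ℝ => m * Real.exp (ξ * ρ)) atTop atTop :=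
    (Real.tendsto_exp_atTop.comp (tendsto_id.atTop_mul_const hρ)).const_mul_atTop hm
  exact tendsto_atTop_mono' _ ((eventually_ge_atTop 0).mono hM) h1

theorem ExpSqIntegrable.tendsto_lyapunov_ratio {μ : Measure ℝ} (h : ExpSqIntegrable μ)
    {t₀ : ℝ} (ht₀ : 0 < t₀) {ζ : ℝ → ℝ} (hζ : ∀ y : ℝ, 0 ≤ y → 0 ≤ ζ y ∧ levyM μ 1 (ζ y) = y)
    {m ρ : ℝ} (hm : 0 < m) (hρ : 0 < ρ) (hM : ∀ ξ ≥ 0, m * Real.exp (ξ * ρ) ≤ levyM μ 2 ξ)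
    {γ : ℝ} (hγ : γ ∈ Set.Ioo (0 : ℝ) 1)
    (hT1 : Tendsto (fun ξ => levyM μ 4 ξ / (levyM μ 2 (γ * ξ)) ^ 2) atTop (nhds 0)) :
    Tendsto (fun q : ℝ × ℝ => (levyM μ 4 (ζ (q.2 / q.1)) + levyM μ 2 (ζ (q.2 / q.1))) /
      (q.1 * levyM μ 2 (ζ (q.2 / q.1)) ^ 2)) (spaceTimeFilter t₀) (nhds 0) := by
  have hm' : ∀ ξ ≥ 0, m ≤ levyM μ 2 ξ := fun ξ hξ => le_trans
    (le_mul_of_one_le_right hm.le (Real.one_le_exp (mul_nonneg hξ hρ.le))) (hM ξ hξ)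
  have htop := tendsto_levyM_two hm hρ hM
  refine h.tendsto_spaceTimeFilter ht₀ hζ
    (g := fun t ξ => (levyM μ 4 ξ + levyM μ 2 ξ) / (t * levyM μ 2 ξ ^ 2))
    (g₁ := fun ξ => (4 * (levyM μ 4 ξ / (levyM μ 2 (γ * ξ)) ^ 2) + (levyM μ 2 ξ)⁻¹) / t₀)
    ?_ ?_ ?_ ?_
  · intro t ξ ht hξ
    have := levyM_four_nonneg μ ξ
    have := hm.le.trans (hm' ξ hξ)
    positivity
  · simpa using ((hT1.const_mul 4).add htop.inv_tendsto_atTop).div_const t₀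
  · filter_upwards [htop.eventually_ge_atTop (levyM μ 2 0), eventually_ge_atTop 0] with ξ h1 h2 t ht
    have h3 := levyM_four_nonneg μ ξ
    have h4 := hm.trans_le (hm' ξ h2)
    have h5 := hm.trans_le (hm' (γ * ξ) (mul_nonneg hγ.1.le h2))
    have h6 : levyM μ 2 (γ * ξ) ≤ 2 * levyM μ 2 ξ := by
      have := h.levyM_two_le (mul_nonneg hγ.1.le h2) (mul_le_of_le_one_left h2 hγ.2.le)
      linarith
    calc (levyM μ 4 ξ + levyM μ 2 ξ) / (t * levyM μ 2 ξ ^ 2)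
        ≤ (levyM μ 4 ξ + levyM μ 2 ξ) / (t₀ * levyM μ 2 ξ ^ 2) := by gcongr
      _ = (4 * (levyM μ 4 ξ / (2 * levyM μ 2 ξ) ^ 2) + (levyM μ 2 ξ)⁻¹) / t₀ := by
          field_simp; ring
      _ ≤ _ := by gcongr
  · intro R hR
    refine ⟨fun t => (levyM μ 4 0 + levyM μ 4 R + (levyM μ 2 0 + levyM μ 2 R)) / m ^ 2 * t⁻¹,
      ?_, ?_⟩
    · have h0 : Tendsto (fun t : ℝ => t⁻¹) atTop (nhds 0) := tendsto_inv_atTop_zero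
      have h1 := h0.const_mul
        ((levyM μ 4 0 + levyM μ 4 R + (levyM μ 2 0 + levyM μ 2 R)) / m ^ 2)
      rwa [mul_zero] at h1
    filter_upwards [eventually_gt_atTop 0] with t ht ξ hξ
    have h1 := h.levyM_two_le hξ.1 hξ.2
    have h2 := h.levyM_four_le hξ.1 hξ.2
    have h3 := hm' ξ hξ.1
    have h4 := levyM_four_nonneg μ ξ
    calc _ ≤ (levyM μ 4 0 + levyM μ 4 R + (levyM μ 2 0 + levyM μ 2 R)) / (t * m ^ 2) := by
          gcongr
          linarith
      _ = _ := by field_simp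

theorem ExpSqIntegrable.tendsto_frequency_tail {μ : Measure ℝ} (h : ExpSqIntegrable μ)
    {t₀ : ℝ} (ht₀ : 0 < t₀) {ζ : ℝ → ℝ} (hζ : ∀ y : ℝ, 0 ≤ y → 0 ≤ ζ y ∧ levyM μ 1 (ζ y) = y)
    {m ρ k : ℝ} (hm : 0 < m) (hρ : 0 < ρ) (hk : 0 < k)
    (hM : ∀ ξ ≥ 0, m * Real.exp (ξ * ρ) ≤ levyM μ 2 ξ)
    (hT2 : Tendsto
      (fun ξ => (Real.log (max (levyM μ 4 ξ / levyM μ 2 ξ) 1)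
        + Real.log (Real.log (levyM μ 2 ξ))) / ξ) atTop (nhds 0)) :
    Tendsto (fun q : ℝ × ℝ => Real.sqrt (q.1 * levyM μ 2 (ζ (q.2 / q.1))) *
      Real.exp (-(k * (q.1 * (levyM μ 2 (ζ (q.2 / q.1)) /
        (levyM μ 4 (ζ (q.2 / q.1)) + levyM μ 2 (ζ (q.2 / q.1))) *
          Real.exp (ζ (q.2 / q.1) * ρ)))))) (spaceTimeFilter t₀) (nhds 0) := by
  have hm' : ∀ ξ ≥ 0, m ≤ levyM μ 2 ξ := fun ξ hξ => le_trans
    (le_mul_of_one_le_right hm.le (Real.one_le_exp (mul_nonneg hξ hρ.le))) (hM ξ hξ)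
  have htop := tendsto_levyM_two hm hρ hM
  have hE : Tendsto (fun ξ : ℝ => Real.exp (ρ / 4 * ξ)) atTop atTop :=
    Real.tendsto_exp_atTop.comp (tendsto_id.const_mul_atTop (by positivity))
  refine h.tendsto_spaceTimeFilter ht₀ hζ
    (g := fun t ξ => Real.sqrt (t * levyM μ 2 ξ) * Real.exp (-(k * (t * (levyM μ 2 ξ /
        (levyM μ 4 ξ + levyM μ 2 ξ) * Real.exp (ξ * ρ))))))
    (g₁ := fun ξ => 4 / k * (Real.sqrt t₀)⁻¹ * (Real.exp (ρ / 4 * ξ))⁻¹) ?_ ?_ ?_ ?_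
  · intro t ξ _ _
    positivity
  · simpa using hE.inv_tendsto_atTop.const_mul (4 / k * (Real.sqrt t₀)⁻¹)
  · filter_upwards [htop.eventually_ge_atTop (Real.exp 1), eventually_gt_atTop 0,
      hT2.eventually_lt_const (show 0 < ρ / 4 by positivity),
      hE.eventually_ge_atTop (2 / (k * t₀) + 1)] with ξ h1 h2 h3 h4 t ht
    have ht' := ht₀.trans_le ht
    set M := levyM μ 2 ξ with hMdef
    set E := Real.exp (ρ / 4 * ξ) with hEdef
    have hE1 : 1 ≤ E := Real.one_le_exp (by positivity)
    have hM0 : 0 < M := (Real.exp_pos 1).trans_le h1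
    have h40 := levyM_four_nonneg μ ξ
    have hl1 : 1 ≤ Real.log M := by rwa [Real.le_log_iff_exp_le hM0]
    have hl2 : 0 ≤ Real.log (Real.log M) := Real.log_nonneg hl1
    have hl3 : 0 ≤ Real.log (max (levyM μ 4 ξ / M) 1) := Real.log_nonneg (le_max_right _ _)
    rw [div_lt_iff₀ h2] at h3
    have h5 : M ≤ Real.exp E := by
      rw [← Real.log_le_iff_le_exp hM0, hEdef, ← Real.log_le_iff_le_exp (by linarith)]
      linarith
    have h6 : levyM μ 4 ξ / M ≤ E := by
      refine (le_max_left _ 1).trans ?_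
      rw [hEdef, ← Real.log_le_iff_le_exp (by positivity)]
      linarith
    have h7 : 1 / (2 * E) ≤ M / (levyM μ 4 ξ + M) := by
      rw [div_le_div_iff₀ (by positivity) (by positivity)]
      rw [div_le_iff₀ hM0] at h6
      nlinarith
    have h8 : Real.exp (ξ * ρ) = E ^ 4 := by
      rw [hEdef, ← Real.exp_nat_mul]; congr 1; push_cast; ring
    have h9 : E ^ 3 / 2 ≤ M / (levyM μ 4 ξ + M) * Real.exp (ξ * ρ) := by
      rw [h8]
      calc E ^ 3 / 2 = 1 / (2 * E) * E ^ 4 := by field_simp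
        _ ≤ _ := by gcongr
    have h10 : Real.sqrt M ≤ Real.exp (E / 2) := by
      rw [Real.sqrt_le_left (Real.exp_pos _).le, ← Real.exp_nat_mul]
      convert h5 using 2
      push_cast; ring
    have h11 : E / 2 ≤ k * (t * (E ^ 3 / 4)) := by
      have a1 : 2 ≤ k * t * E := by
        have a2 : 2 / (k * t₀) ≤ E := by linarith
        rw [div_le_iff₀ (by positivity)] at a2
        calc (2 : ℝ) ≤ E * (k * t₀) := a2
          _ ≤ E * (k * t) := by gcongr
          _ = _ := by ring
      have a3 : 2 * (E * E) ≤ k * t * E * (E * E) := by gcongr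
      nlinarith
    have h12 : k * (E / 4) * t ≤ k * (t * (E ^ 3 / 4)) := by
      have : E ≤ E ^ 3 := le_self_pow₀ hE1 (by norm_num)
      calc k * (E / 4) * t = k * (t * (E / 4)) := by ring
        _ ≤ _ := by gcongr
    have h13 : k * (t * (E ^ 3 / 2)) ≤
        k * (t * (M / (levyM μ 4 ξ + M) * Real.exp (ξ * ρ))) := by gcongr
    calc Real.sqrt (t * M) * Real.exp (-(k * (t * (M / (levyM μ 4 ξ + M) * Real.exp (ξ * ρ)))))
        ≤ (Real.sqrt t * Real.exp (E / 2)) * Real.exp (-(E / 2) + -(k * (E / 4) * t)) := by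
          rw [Real.sqrt_mul ht'.le]
          gcongr
          linarith
      _ = Real.sqrt t * Real.exp (-(k * (E / 4) * t)) := by
          rw [mul_assoc, ← Real.exp_add]; congr 2; ring
      _ ≤ 1 / (k * (E / 4)) * (Real.sqrt t)⁻¹ := sqrt_mul_exp_neg_le (by positivity) ht'
      _ ≤ 1 / (k * (E / 4)) * (Real.sqrt t₀)⁻¹ := by
          have := Real.sqrt_pos.2 ht₀
          gcongr
      _ = _ := by field_simp
  · intro R hR
    set B := levyM μ 4 0 + levyM μ 4 R + (levyM μ 2 0 + levyM μ 2 R) with hB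
    have hB0 : 0 < B := by
      linarith [levyM_four_nonneg μ 0, levyM_four_nonneg μ R, hm' 0 le_rfl, hm' R hR]
    have hq : 0 < k * (m / B) := by positivity
    refine ⟨fun t => Real.sqrt B * (1 / (k * (m / B)) * (Real.sqrt t)⁻¹), ?_, ?_⟩
    · simpa using (Real.tendsto_sqrt_atTop.inv_tendsto_atTop.const_mul
        (1 / (k * (m / B)))).const_mul (Real.sqrt B)
    filter_upwards [eventually_gt_atTop 0] with t ht ξ hξ
    have h1 := h.levyM_two_le hξ.1 hξ.2
    have h2 := h.levyM_four_le hξ.1 hξ.2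
    have h3 := hm' ξ hξ.1
    have h4 := levyM_four_nonneg μ ξ
    have h5 := levyM_four_nonneg μ 0
    have h6 := levyM_four_nonneg μ R
    have h7 : m / B ≤ levyM μ 2 ξ / (levyM μ 4 ξ + levyM μ 2 ξ) * Real.exp (ξ * ρ) := by
      calc m / B = m / B * 1 := (mul_one _).symm
        _ ≤ _ := by
          refine mul_le_mul ?_ (Real.one_le_exp (mul_nonneg hξ.1 hρ.le)) zero_le_one
            (by have := hm.trans_le h3; positivity)
          have := hm.trans_le h3
          gcongr
          linarith
    have h8 : k * (m / B) * t ≤ k * (t * (levyM μ 2 ξ / (levyM μ 4 ξ + levyM μ 2 ξ) *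
        Real.exp (ξ * ρ))) := by
      calc k * (m / B) * t = k * (t * (m / B)) := by ring
        _ ≤ _ := by gcongr
    calc _ ≤ Real.sqrt (t * B) * Real.exp (-(k * (m / B) * t)) := by
          gcongr
          linarith
      _ = Real.sqrt B * (Real.sqrt t * Real.exp (-(k * (m / B) * t))) := by
          rw [Real.sqrt_mul ht.le]; ring
      _ ≤ _ := by
          exact mul_le_mul_of_nonneg_left (sqrt_mul_exp_neg_le hq ht) (Real.sqrt_nonneg B)

end LevyAsymptotics

/-- Corollary 4.1, statement (1); relation (answ41): the transition density of
the Lévy process satisfies `p_t(x) ∼ (2πt𝒦_Z(x/t))^{−1/2} e^{t𝒟_Z(x/t)}` as `t + x → ∞`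
over `[t₀,∞) × [0,∞)`. -/
theorem levy_density_space_time_asymptotics
    (μ : Measure ℝ)
    (hμ0 : μ {0} = 0)
    (hμint : Integrable (fun u : ℝ => min 1 (u ^ 2)) μ)
    (hμpos : 0 < μ (Set.Ioi (0 : ℝ)))
    (hμexp : ∀ C : ℝ, Integrable (fun u : ℝ => Real.exp (C * u)) (μ.restrict {u : ℝ | 1 ≤ |u|}))
    (γ : ℝ) (hγ : γ ∈ Set.Ioo (0 : ℝ) 1)
    (hT1 : Tendsto (fun ξ => levyM μ 4 ξ / (levyM μ 2 (γ * ξ)) ^ 2) atTop (nhds 0))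
    (hT2 : Tendsto
      (fun ξ => (Real.log (max (levyM μ 4 ξ / levyM μ 2 ξ) 1)
        + Real.log (Real.log (levyM μ 2 ξ))) / ξ) atTop (nhds 0))
    (hN1 : Tendsto (fun z : ℝ => z ^ 2 * (∫ u in Set.Ioo 0 |z|⁻¹, u ^ 2 ∂μ) / Real.log |z|)
      (comap (fun z : ℝ => |z|) atTop) atTop)
    (hC : ∃ ρ > (0 : ℝ), ∀ ε > (0 : ℝ), ∃ c : ℝ,
      c < (μ (Set.Ici ρ)).toReal ∧
      ∀ z : ℝ, ε ≤ |z| →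
        ‖∫ y in Set.Ici ρ, Complex.exp (Complex.I * y * z) ∂μ‖ ≤ c)
    (ζ : ℝ → ℝ)
    (hζ : ∀ y : ℝ, 0 ≤ y → 0 ≤ ζ y ∧ levyM μ 1 (ζ y) = y)
    (𝒟 𝒦 : ℝ → ℝ)
    (h𝒟 : ∀ y : ℝ, 𝒟 y = -(y * ζ y) + levyM μ 0 (ζ y))
    (h𝒦 : ∀ y : ℝ, 𝒦 y = levyM μ 2 (ζ y))
    (p : ℝ → ℝ → ℝ)
    (hp : ∀ t x : ℝ, p t x = (1 / (2 * Real.pi)) *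
      (∫ z : ℝ, Complex.exp (-(Complex.I * z * x) + t * levyPsi μ z)).re) :
    (∀ t > (0 : ℝ), ∀ x : ℝ,
      Integrable (fun z : ℝ => Complex.exp (-(Complex.I * z * x) + t * levyPsi μ z)))
    ∧ ∀ t₀ > (0 : ℝ), ∀ ε > (0 : ℝ), ∃ N : ℝ, ∀ t x : ℝ,
        t₀ ≤ t → 0 ≤ x → N ≤ t + x →
        |p t x * Real.sqrt (2 * Real.pi * t * 𝒦 (x / t))
          * Real.exp (-(t * 𝒟 (x / t))) - 1| < ε := by
  have h := expSqIntegrable_of_levy hμint hμexp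
  obtain ⟨ρ, hρ, hC⟩ := hC
  obtain ⟨c, hc0, hc⟩ := exists_cramer_le_tiltedDecay h hμint hρ hC
  have hκ : 0 < (μ (Set.Ici ρ)).toReal := by
    obtain ⟨c, hc, hc'⟩ := hC 1 one_pos
    exact ((norm_nonneg _).trans (hc' 1 (by simp))).trans_lt hc
  have hm : 0 < ρ ^ 2 * (μ (Set.Ici ρ)).toReal := by positivity
  have hM : ∀ ξ ≥ 0, ρ ^ 2 * (μ (Set.Ici ρ)).toReal * Real.exp (ξ * ρ) ≤ levyM μ 2 ξ :=
    fun ξ hξ => h.le_levyM_two hμint hρ hξ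
  have hM0 : ∀ ξ ≥ 0, 0 < levyM μ 2 ξ := fun ξ hξ =>
    lt_of_lt_of_le (by positivity) (hM ξ hξ)
  refine ⟨fun t ht x => ?_, fun t₀ ht₀ ε hε => ?_⟩
  · obtain ⟨C, _, hC⟩ := exists_exp_neg_tiltedDecay_le h hN1 ht
    have hcont : Continuous (levyPsi μ) := by
      rw [← funext (tiltedPsi_zero μ)]
      exact h.continuous_tiltedPsi 0
    refine (integrable_inv_one_add_sq.const_mul C).mono' (by fun_prop)
      (Eventually.of_forall fun z => ?_)
    have e : -(Complex.I * z * x) = ((-(z * x) : ℝ) : ℂ) * Complex.I := by push_cast; ring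
    rw [Complex.exp_add, norm_mul, e, Complex.norm_exp_ofReal_mul_I, one_mul, ← tiltedPsi_zero,
      h.norm_cexp_tiltedPsi]
    exact hC t le_rfl 0 le_rfl z
  · obtain ⟨C, hC0, hC⟩ := exists_exp_neg_tiltedDecay_le h hN1 (half_pos ht₀)
    have hpos : ∀ᶠ q in spaceTimeFilter t₀, t₀ ≤ q.1 ∧ 0 ≤ q.2 :=
      eventually_spaceTimeFilter.2 ⟨0, fun t x ht hx _ => ⟨ht, hx⟩⟩
    have hpos' : ∀ᶠ q in spaceTimeFilter t₀, 0 ≤ ζ (q.2 / q.1) := by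
      filter_upwards [hpos] with q hq
      exact (hζ _ (div_nonneg hq.2 (ht₀.le.trans hq.1))).1
    have hlim := h.tendsto_saddle_integral (L := spaceTimeFilter t₀) (τ := fun q => q.1)
      (ξ := fun q => ζ (q.2 / q.1)) (hpos.mono fun q hq => ht₀.trans_le hq.1) hpos' hM0 hC0 hc0 hc
      (by
        filter_upwards [hpos, hpos'] with q hq hq'
        exact hC (q.1 / 2) (by linarith [hq.1]) _ hq')
      (h.tendsto_lyapunov_ratio ht₀ hζ hm hρ hM hγ hT1)
      (h.tendsto_frequency_tail ht₀ hζ hm hρ (by positivity) hM hT2)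
    have hs2 : 0 < Real.sqrt (2 * Real.pi) := Real.sqrt_pos.2 (by positivity)
    have hlim' := ((Complex.continuous_re.tendsto _).comp hlim).div_const (Real.sqrt (2 * Real.pi))
    rw [Complex.ofReal_re, div_self hs2.ne'] at hlim'
    have hev := eventually_spaceTimeFilter.1 (Metric.tendsto_nhds.1 hlim' ε hε)
    obtain ⟨N, hN⟩ := hev
    refine ⟨N, fun t x ht hx hN' => ?_⟩
    have h1 := hN t x ht hx hN'
    rw [Real.dist_eq] at h1
    convert h1 using 3
    have ht' := ht₀.trans_le ht
    obtain ⟨hξ, hξ1⟩ := hζ (x / t) (div_nonneg hx ht'.le)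
    have hxt : x = t * levyM μ 1 (ζ (x / t)) := by rw [hξ1]; field_simp
    have hb : ∀ s ≥ 0, ∀ z : ℝ,
        Real.exp (-(t * tiltedDecay μ s z)) ≤ C * (1 + z ^ 2)⁻¹ :=
      fun s hs z => hC t (by linarith) s hs z
    rw [hp, h.integral_cexp_levyPsi ht' hx hξ hxt hb, h𝒟, h𝒦]
    simp only [Function.comp]
    set ξ := ζ (x / t)
    rw [Complex.re_ofReal_mul, Complex.re_ofReal_mul]
    set J := (∫ z : ℝ, Complex.exp (t * tiltedPsi μ ξ z)).re
    have e1 : Real.exp (t * levyM μ 0 ξ - x * ξ) *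
        Real.exp (-(t * (-(x / t * ξ) + levyM μ 0 ξ))) = 1 := by
      rw [← Real.exp_add, Real.exp_eq_one_iff]
      field_simp
      ring
    have e2 : Real.sqrt (2 * Real.pi * t * levyM μ 2 ξ) =
        Real.sqrt (2 * Real.pi) * Real.sqrt (t * levyM μ 2 ξ) := by
      rw [mul_assoc, Real.sqrt_mul (by positivity)]
    have e3 : 2 * Real.pi = Real.sqrt (2 * Real.pi) * Real.sqrt (2 * Real.pi) :=
      (Real.mul_self_sqrt (by positivity)).symm
    rw [e2]
    calc _ = 1 / (2 * Real.pi) * (Real.sqrt (2 * Real.pi) * Real.sqrt (t * levyM μ 2 ξ)) * J *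
          (Real.exp (t * levyM μ 0 ξ - x * ξ) *
            Real.exp (-(t * (-(x / t * ξ) + levyM μ 0 ξ)))) := by ring
      _ = 1 / (Real.sqrt (2 * Real.pi) * Real.sqrt (2 * Real.pi)) *
          (Real.sqrt (2 * Real.pi) * Real.sqrt (t * levyM μ 2 ξ)) * J := by
          rw [e1, mul_one, ← e3]
      _ = _ := by field_simp
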